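/- With the setup of the context, assume in addition that Γ is infinite and that ⋂_{n≥0} Γ_n = {1}. Let X = ⋂_{n≥1} X_n. Then X has no off-diagonal asymptotic pairs under the shift action: for all x, y ∈ X, if the set {g ∈ Γ : x(g) ≠ y(g)} is finite, then x = y. -/

import Mathlib

/-- The combinatorial setup of Section 5: a chain of finite-index normal subgroups
`Γs n` of `Γ` with `Γs 0 = Γ`, transversals `T n` of `Γs n` in `Γs (n-1)`, the fundamental
domains `E n = T n · E (n-1)` (with `E 0 = {1}`), and inductively chosen pattern sets
`A n ⊆ (ℤ/3ℤ)^{E n}` with distinguished patterns `w n ∈ A n` and sum-patterns `s n`,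
such that every `v ∈ A n` restricts to `w (n-1)` on `E (n-1)`, its translate by every
`t ∈ T n \ {1}` lies in `A (n-1) \ {w (n-1)}`, and the sum of all its `T n`-translates
equals `s (n-1)`. -/
structure SubshiftSetup (Γ : Type*) [Group Γ] where
  Γs : ℕ → Subgroup Γ
  Γs_zero : Γs 0 = ⊤
  Γs_antitone : ∀ n : ℕ, Γs (n + 1) ≤ Γs n
  Γs_normal : ∀ n : ℕ, (Γs n).Normal
  Γs_finiteIndex : ∀ n : ℕ, (Γs n).FiniteIndex
  T : ℕ → Finset Γ
  one_mem_T : ∀ n : ℕ, 1 ≤ n → (1 : Γ) ∈ T n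
  T_subset : ∀ n : ℕ, 1 ≤ n → ∀ t ∈ T n, t ∈ Γs (n - 1)
  T_coset : ∀ n : ℕ, 1 ≤ n → ∀ g ∈ Γs (n - 1), ∃! t : Γ, t ∈ T n ∧ g * t⁻¹ ∈ Γs n
  E : ℕ → Finset Γ
  E_zero : E 0 = {1}
  E_succ : ∀ n : ℕ, 1 ≤ n → ∀ g : Γ, g ∈ E n ↔ ∃ t ∈ T n, ∃ e ∈ E (n - 1), g = t * e
  mul_mem_E : ∀ n : ℕ, 1 ≤ n → ∀ t ∈ T n, ∀ f ∈ E (n - 1), t * f ∈ E n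
  A : (n : ℕ) → Set ({x : Γ // x ∈ E n} → ZMod 3)
  w : (n : ℕ) → {x : Γ // x ∈ E n} → ZMod 3
  s : (n : ℕ) → {x : Γ // x ∈ E n} → ZMod 3
  w_mem_A : ∀ n : ℕ, w n ∈ A n
  A_zero : A 0 = Set.univ
  A_restrict : ∀ (n : ℕ) (hn : 1 ≤ n), ∀ v ∈ A n,
    (fun f : {x : Γ // x ∈ E (n - 1)} =>
      v ⟨(1 : Γ) * f.1, mul_mem_E n hn 1 (one_mem_T n hn) f.1 f.2⟩) = w (n - 1)
  A_translate : ∀ (n : ℕ) (hn : 1 ≤ n), ∀ v ∈ A n, ∀ (t : Γ) (ht : t ∈ T n), t ≠ 1 →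
    (fun f : {x : Γ // x ∈ E (n - 1)} =>
      v ⟨t * f.1, mul_mem_E n hn t ht f.1 f.2⟩) ∈ A (n - 1) ∧
    (fun f : {x : Γ // x ∈ E (n - 1)} =>
      v ⟨t * f.1, mul_mem_E n hn t ht f.1 f.2⟩) ≠ w (n - 1)
  A_sum : ∀ (n : ℕ) (hn : 1 ≤ n), ∀ v ∈ A n, ∀ f : {x : Γ // x ∈ E (n - 1)},
    ∑ t ∈ (T n).attach, v ⟨t.1 * f.1, mul_mem_E n hn t.1 t.2 f.1 f.2⟩ = s (n - 1) f

variable {Γ : Type*} [Group Γ]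

/-- The set `R n`: points `x : Γ → ℤ/3ℤ` such that for every `g ∈ Γs n` the pattern
`f ↦ x (g * f)` on `E n` belongs to `A n`. -/
def SubshiftSetup.R (S : SubshiftSetup Γ) (n : ℕ) : Set (Γ → ZMod 3) :=
  {x | ∀ g ∈ S.Γs n, (fun f : {y : Γ // y ∈ S.E n} => x (g * f.1)) ∈ S.A n}

/-- The set `X n`: points `x` such that `h ↦ x (g * h)` belongs to `R n` for some `g ∈ E n`. -/
def SubshiftSetup.Xn (S : SubshiftSetup Γ) (n : ℕ) : Set (Γ → ZMod 3) :=
  {x | ∃ g ∈ S.E n, (fun h : Γ => x (g * h)) ∈ S.R n}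

namespace SubshiftSetup

/-- Every coset of `Γs n` in `Γ` meets the fundamental domain `E n`. -/
lemma exists_eq_mul_mem_E (S : SubshiftSetup Γ) (n : ℕ) (g : Γ) :
    ∃ γ ∈ S.Γs n, ∃ e ∈ S.E n, g = γ * e := by
  induction n with
  | zero => exact ⟨g, by simp [S.Γs_zero], 1, by simp [S.E_zero], by simp⟩
  | succ n ih =>
    obtain ⟨γ, hγ, e, he, rfl⟩ := ih
    obtain ⟨t, ⟨ht, hγt⟩, -⟩ := S.T_coset (n + 1) (by omega) γ hγ
    exact ⟨γ * t⁻¹, hγt, t * e, S.mul_mem_E (n + 1) (by omega) t ht e he, by group⟩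

lemma pattern_eq_w (S : SubshiftSetup Γ) {n : ℕ} {x : Γ → ZMod 3} (hx : x ∈ S.R (n + 1))
    {γ : Γ} (hγ : γ ∈ S.Γs (n + 1)) :
    (fun f : {y : Γ // y ∈ S.E n} => x (γ * f.1)) = S.w n := by
  have h := S.A_restrict (n + 1) (by omega) _ (hx γ hγ)
  simp only [one_mul] at h
  exact h

lemma pattern_mem_A_and_ne_w (S : SubshiftSetup Γ) {n : ℕ} {x : Γ → ZMod 3}
    (hx : x ∈ S.R (n + 1)) {γ : Γ} (hγ : γ ∈ S.Γs n) (hγ' : γ ∉ S.Γs (n + 1)) :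
    (fun f : {y : Γ // y ∈ S.E n} => x (γ * f.1)) ∈ S.A n ∧
      (fun f : {y : Γ // y ∈ S.E n} => x (γ * f.1)) ≠ S.w n := by
  obtain ⟨t, ⟨ht, hγt⟩, -⟩ := S.T_coset (n + 1) (by omega) γ hγ
  have ht1 : t ≠ 1 := by
    rintro rfl
    exact hγ' (by simpa using hγt)
  have h := S.A_translate (n + 1) (by omega) _ (hx _ hγt) t ht ht1
  have hcancel : ∀ f : Γ, γ * t⁻¹ * (t * f) = γ * f := fun f => by group
  simp only [hcancel] at h
  exact h

lemma R_succ_subset (S : SubshiftSetup Γ) (n : ℕ) : S.R (n + 1) ⊆ S.R n := by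
  intro x hx γ hγ
  by_cases hγ' : γ ∈ S.Γs (n + 1)
  · rw [S.pattern_eq_w hx hγ']
    exact S.w_mem_A n
  · exact (S.pattern_mem_A_and_ne_w hx hγ hγ').1

lemma translate_mem_R (S : SubshiftSetup Γ) {n : ℕ} {x : Γ → ZMod 3} (hx : x ∈ S.R n)
    {γ : Γ} (hγ : γ ∈ S.Γs n) : (fun h => x (γ * h)) ∈ S.R n := by
  intro δ hδ
  have h := hx (γ * δ) (mul_mem hγ hδ)
  simpa only [mul_assoc] using h

lemma Γs_antitone_nat (S : SubshiftSetup Γ) : Antitone S.Γs :=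
  antitone_nat_of_succ_le S.Γs_antitone

lemma infinite_Γs (S : SubshiftSetup Γ) [Infinite Γ] (n : ℕ) : (S.Γs n : Set Γ).Infinite := by
  intro hfin
  have hidx := S.Γs_finiteIndex n
  have hsub : Finite (S.Γs n) := hfin
  have : Finite Γ := (Subgroup.finite_iff_finite_and_finiteIndex (H := S.Γs n)).2 ⟨hsub, hidx⟩
  exact not_finite Γ

/-- If every translate of a finite set `E` by an element of `H` meets `D`, and `H` is infinite,
then so is `D`. -/
lemma infinite_of_forall_exists_mul_mem {H D : Set Γ} (E : Finset Γ) (g : Γ) (hH : H.Infinite)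
    (h : ∀ γ ∈ H, ∃ f ∈ E, g * (γ * f) ∈ D) : D.Infinite := by
  intro hD
  refine hH ((hD.image2 (fun d f => g⁻¹ * d * f⁻¹) E.finite_toSet).subset ?_)
  intro γ hγ
  obtain ⟨f, hf, hd⟩ := h γ hγ
  exact ⟨_, hd, f, hf, by group⟩

/-- Asymptotic points have the same position relative to the cosets of `Γs n`. -/
lemma inv_mul_mem_Γs (S : SubshiftSetup Γ) [Infinite Γ] {x y : Γ → ZMod 3}
    (hfin : {g : Γ | x g ≠ y g}.Finite) (n : ℕ) {g h : Γ}
    (hx : (fun a => x (g * a)) ∈ S.R n) (hy : (fun a => y (h * a)) ∈ S.R n) :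
    h⁻¹ * g ∈ S.Γs n := by
  induction n with
  | zero => simp [S.Γs_zero]
  | succ n ih =>
    have hn := ih (S.R_succ_subset n hx) (S.R_succ_subset n hy)
    by_contra hcon
    refine infinite_of_forall_exists_mul_mem (S.E n) g (S.infinite_Γs (n + 1)) ?_ hfin
    intro γ hγ
    have hw := S.pattern_eq_w hx hγ
    have hne := (S.pattern_mem_A_and_ne_w hy (mul_mem hn (S.Γs_antitone n hγ))
      (fun hmem => hcon ((Subgroup.mul_mem_cancel_right _ hγ).1 hmem))).2
    by_contra! hall
    refine hne (Eq.trans ?_ hw)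
    funext f
    have hf : x (g * (γ * f.1)) = y (g * (γ * f.1)) := by
      simpa using hall f.1 f.2
    rw [hf]
    congr 1
    group

/-- A finite set of elements is separated by the cosets of `Γs n` for some `n`. -/
lemma exists_separating (S : SubshiftSetup Γ)
    (hinter : ∀ g : Γ, (∀ n : ℕ, g ∈ S.Γs n) → g = 1) {D : Set Γ} (hD : D.Finite) (p : Γ) :
    ∃ n, ∀ q ∈ D, p⁻¹ * q ∈ S.Γs n → q = p := by
  induction D, hD using Set.Finite.induction_on with
  | empty => exact ⟨0, by simp⟩
  | @insert a D _ _ ih =>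
    obtain ⟨n, hn⟩ := ih
    obtain ⟨m, hm⟩ : ∃ m, p⁻¹ * a ∈ S.Γs m → a = p := by
      by_contra! hcon
      have := hinter _ fun m => (hcon m).1
      exact (hcon 0).2 (inv_mul_eq_one.1 this).symm
    refine ⟨max n m, ?_⟩
    rintro q (rfl | hq) hmem
    · exact hm (S.Γs_antitone_nat (le_max_right n m) hmem)
    · exact hn q hq (S.Γs_antitone_nat (le_max_left n m) hmem)

end SubshiftSetup

theorem no_offdiagonal_asymptotic_pairs (S : SubshiftSetup Γ)
    (hΓinf : Infinite Γ)
    (hinter : ∀ g : Γ, (∀ n : ℕ, g ∈ S.Γs n) → g = 1)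
    (X : Set (Γ → ZMod 3))
    (hX : X = ⋂ (n : ℕ) (_ : 1 ≤ n), S.Xn n) :
    ∀ x ∈ X, ∀ y ∈ X, {g : Γ | x g ≠ y g}.Finite → x = y := by
  intro x hx y hy hfin
  subst hX
  simp only [Set.mem_iInter] at hx hy
  funext p
  obtain ⟨n, hn⟩ := S.exists_separating hinter hfin p
  obtain ⟨g, -, hgx⟩ := hx (n + 1) (by omega)
  obtain ⟨h, -, hhy⟩ := hy (n + 1) (by omega)
  have hgy : (fun a => y (g * a)) ∈ S.R (n + 1) := by
    have := S.translate_mem_R hhy (S.inv_mul_mem_Γs hfin (n + 1) hgx hhy)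
    simpa only [mul_assoc, mul_inv_cancel_left] using this
  obtain ⟨γ, hγ, e, he, hp⟩ := S.exists_eq_mul_mem_E (n + 1) (g⁻¹ * p)
  obtain ⟨t, ht, f, hf, rfl⟩ := (S.E_succ (n + 1) (by omega) e).1 he
  have hpeq : p = g * (γ * (t * f)) := by rw [← hp]; group
  have hsx := S.A_sum (n + 1) (by omega) _ (hgx γ hγ) ⟨f, hf⟩
  have hsy := S.A_sum (n + 1) (by omega) _ (hgy γ hγ) ⟨f, hf⟩
  have hsub := sub_eq_zero.2 (hsx.trans hsy.symm)
  rw [← Finset.sum_sub_distrib, Finset.sum_eq_single ⟨t, ht⟩] at hsub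
  · simpa [hpeq, sub_eq_zero] using hsub
  · rintro ⟨t', ht'⟩ - hne
    by_contra hdiff
    have hmem : g * (γ * (t' * f)) ∈ {a : Γ | x a ≠ y a} := fun heq => hdiff (sub_eq_zero.2 heq)
    have hconj : p⁻¹ * (g * (γ * (t' * f))) ∈ S.Γs n := by
      have h1 : t⁻¹ * t' ∈ S.Γs n :=
        mul_mem (inv_mem (S.T_subset (n + 1) (by omega) t ht))
          (S.T_subset (n + 1) (by omega) t' ht')
      have h2 := (S.Γs_normal n).conj_mem _ h1 f⁻¹
      convert h2 using 1
      rw [hpeq]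
      group
    have heq := hn _ hmem hconj
    rw [hpeq] at heq
    exact hne (Subtype.ext (by simpa using heq))
  · intro hnot
    exact absurd (Finset.mem_attach _ _) hnot
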